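/- There exists an automorphism σ ∈ Aut(F/K) with σ(x) = 1/x and σ(y) = y/x if and only if 3 divides n and m/s divides q^2 − q + 1. -/

import Mathlib

open MvPolynomial

/-- The defining ideal of the curve `Y_{n,s}` : it is generated by
`Z^(m/s) - (Y^(q^2) - Y)` and `Y^(q+1) - (X^q + X)` in `K[X,Y,Z]`
(variables `X 0 = X`, `X 1 = Y`, `X 2 = Z`, and `t` stands for `m/s`). -/
noncomputable def YIdeal (K : Type) [Field K] (q t : ℕ) : Ideal (MvPolynomial (Fin 3) K) :=
  Ideal.span {X 2 ^ t - (X 1 ^ (q ^ 2) - X 1), X 1 ^ (q + 1) - (X 0 ^ q + X 0)}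

/-- The coordinate ring `K[X,Y,Z]/I` of the curve `Y_{n,s}`. -/
noncomputable abbrev YRing (K : Type) [Field K] (q t : ℕ) :=
  MvPolynomial (Fin 3) K ⧸ YIdeal K q t

/-- The function field `F = Frac(K[X,Y,Z]/I)` of the curve `Y_{n,s}`. -/
noncomputable abbrev YField (K : Type) [Field K] (q t : ℕ) :=
  FractionRing (YRing K q t)

/-- The coordinate function `x ∈ F`, image of the variable `X`. -/
noncomputable def Yx (K : Type) [Field K] (q t : ℕ) : YField K q t :=
  algebraMap (YRing K q t) (YField K q t) (Ideal.Quotient.mk _ (X 0))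

/-- The coordinate function `y ∈ F`, image of the variable `Y`. -/
noncomputable def Yy (K : Type) [Field K] (q t : ℕ) : YField K q t :=
  algebraMap (YRing K q t) (YField K q t) (Ideal.Quotient.mk _ (X 1))

namespace Polynomial

lemma aux_three (q n m t : ℕ) (hodd : Odd n) (hm : m * (q + 1) = q ^ n + 1)
    (ht : 1 < t) (htm : t ∣ m) (htN : t ∣ q ^ 2 - q + 1) : 3 ∣ n := by
  by_contra h3
  have hle : q ≤ q ^ 2 := Nat.le_self_pow (by norm_num) q
  have hN : (q : ZMod t) ^ 2 - q + 1 = 0 := by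
    have := (ZMod.natCast_eq_zero_iff _ _).2 htN
    push_cast [Nat.cast_sub hle] at this
    exact this
  have hmz : (m : ZMod t) = 0 := (ZMod.natCast_eq_zero_iff _ _).2 htm
  have hn1 : (q : ZMod t) ^ n = -1 := by
    have := congrArg (Nat.cast (R := ZMod t)) hm
    push_cast at this
    rw [hmz] at this
    linear_combination -this
  generalize hQ : (q : ZMod t) = Q at *
  have hQ3 : Q ^ 3 = -1 := by linear_combination (Q + 1) * hN
  have hQ6 : Q ^ 6 = 1 := by linear_combination (Q ^ 3 - 1) * hQ3
  have hr : Q ^ (n % 6) = -1 := by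
    rw [← hn1]
    conv_rhs => rw [← Nat.div_add_mod n 6, pow_add, pow_mul, hQ6, one_pow, one_mul]
  have h30 : (3 : ZMod t) = 0 := by
    have : n % 6 = 1 ∨ n % 6 = 5 := by
      obtain ⟨k, hk⟩ := hodd
      omega
    rcases this with h | h
    · rw [h] at hr
      linear_combination hN + (-Q + 2) * hr
    · rw [h] at hr
      have h2 : Q ^ 2 = 1 := by linear_combination -hr + Q ^ 2 * hQ3
      have h4 : Q = 2 := by linear_combination h2 - hN
      rw [h4] at h2
      linear_combination h2
  have ht3 : t = 3 := by
    have : t ∣ 3 := (ZMod.natCast_eq_zero_iff 3 t).1 (by exact_mod_cast h30)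
    rcases (Nat.dvd_prime Nat.prime_three).1 this with h | h <;> omega
  subst ht3
  have hQm : Q = -1 := by
    revert hN; clear * -; revert Q; decide
  have hgeo : (m : ℤ) = ∑ i ∈ Finset.range n, (-(q : ℤ)) ^ i := by
    have h1 := geom_sum_mul (-(q : ℤ)) n
    have h2 : ((m : ℤ) * (q + 1)) = q ^ n + 1 := by exact_mod_cast hm
    rw [hodd.neg_pow] at h1
    have h3 : ((q : ℤ) + 1) ≠ 0 := by positivity
    apply mul_right_cancel₀ h3
    linear_combination h2 + h1
  have := congrArg (Int.cast (R := ZMod 3)) hgeo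
  push_cast at this
  rw [hmz, hQ, hQm] at this
  simp at this
  exact h3 ((ZMod.natCast_eq_zero_iff _ _).1 this.symm)

lemma aux_w {F : Type*} [Field F] (p a q : ℕ) (hp : p.Prime) (hq : q = p ^ a) [CharP F p]
    (x y : F) (hx : x ≠ 0) (h2 : y ^ (q + 1) = x ^ q + x) :
    (y / x) ^ (q ^ 2) - y / x = -(y ^ (q ^ 2) - y) / x ^ (q ^ 2 - q + 1) := by
  have := Fact.mk hp
  have hle : q ≤ q ^ 2 := Nat.le_self_pow (by norm_num) q
  obtain ⟨N, hN⟩ : ∃ N, N = q ^ 2 - q + 1 := ⟨_, rfl⟩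
  have hNq : N + q = q ^ 2 + 1 := by omega
  rw [← hN]
  have h3 : y ^ (q ^ 2) * y ^ q = x ^ (q ^ 2) + x ^ q := by
    have := congrArg (· ^ q) h2
    conv_rhs at this => rw [hq, add_pow_char_pow, ← hq]
    rw [← pow_mul, ← pow_mul] at this
    rw [pow_two, ← this]; ring
  have hx' : x ^ (q^2) * x = x ^ N * x ^ q := by rw [← pow_succ, ← pow_add, hNq]
  have e : x ^ q ≠ 0 := pow_ne_zero _ hx
  have e2 : x ^ N ≠ 0 := pow_ne_zero _ hx
  have e3 : x ^ (q^2) ≠ 0 := pow_ne_zero _ hx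
  have hx'' : x ^ N = x ^ (q^2) * x / x ^ q := by field_simp; exact hx'.symm
  rw [hx'', div_pow]
  rw [pow_succ] at h2
  generalize y ^ (q^2) = A at *
  generalize x ^ (q^2) = B at *
  generalize x ^ q = C at *
  generalize y ^ q = D at *
  field_simp
  linear_combination y * h3 - A * h2

lemma aux_rm {K : Type*} [Field K] (p a q : ℕ) [CharP K p] (hp : p.Prime) (ha : 0 < a)
    (hq : q = p ^ a) (c : K) (hc : c ^ q + c = 0) :
    rootMultiplicity c ((X ^ q + X : K[X]) * ((X ^ q + X) ^ (q - 1) - 1) ^ (q + 1)) = 1 := by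
  have hq2 : 2 ≤ q := by
    rw [hq]; exact hp.two_le.trans (Nat.le_self_pow ha.ne' p)
  have hqK : (q : K) = 0 := by
    rw [hq]; push_cast; rw [CharP.cast_eq_zero, zero_pow ha.ne']
  have hu : IsRoot ((((X ^ q + X) ^ (q - 1) - 1) ^ (q + 1) : K[X])) c → False := by
    intro h
    rw [IsRoot.def] at h
    simp [hc, show q - 1 ≠ 0 by omega] at h
  have hg : rootMultiplicity c (X ^ q + X : K[X]) = 1 := by
    have hd : derivative (X ^ q + X : K[X]) = 1 := by
      rw [derivative_add, derivative_X_pow, hqK]; simp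
    have h0 : (X ^ q + X : K[X]) ≠ 0 := by
      intro h; rw [h] at hd; simp at hd
    have hr : IsRoot (X ^ q + X : K[X]) c := by simp [IsRoot.def, hc]
    have h1 := (rootMultiplicity_pos h0).2 hr
    have h2 : ¬ 1 < rootMultiplicity c (X ^ q + X : K[X]) := by
      rw [one_lt_rootMultiplicity_iff_isRoot h0]
      rintro ⟨-, h⟩
      rw [hd] at h; simp at h
    omega
  have hu0 : ((((X ^ q + X) ^ (q - 1) - 1) ^ (q + 1) : K[X])) ≠ 0 := by
    intro h; apply hu; rw [h]; simp
  have h0 : (X ^ q + X : K[X]) ≠ 0 := by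
    intro h; rw [h] at hg; simp at hg
  rw [rootMultiplicity_mul (mul_ne_zero h0 hu0), hg, rootMultiplicity_eq_zero hu]

lemma aux_poly {K : Type*} [Field K] [IsAlgClosed K] (p a q : ℕ) [CharP K p] (hp : p.Prime)
    (ha : 0 < a) (hq : q = p ^ a) (M i e : ℕ) (P Q : K[X]) (hP : P ≠ 0) (hQ : Q ≠ 0)
    (h : X ^ e * Q ^ M = P ^ M * ((X ^ q + X : K[X]) * ((X ^ q + X) ^ (q - 1) - 1) ^ (q + 1)) ^ i) :
    M ∣ e := by
  have hq2 : 2 ≤ q := by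
    rw [hq]; exact hp.two_le.trans (Nat.le_self_pow ha.ne' p)
  obtain ⟨c, hc⟩ := IsAlgClosed.exists_pow_nat_eq (-1 : K) (n := q - 1) (by omega)
  have hc0 : c ≠ 0 := by
    rintro rfl
    rw [zero_pow (by omega)] at hc
    simp at hc
  have hcq : c ^ q + c = 0 := by
    have : c ^ q = c ^ (q - 1) * c := by rw [← pow_succ]; congr 1; omega
    rw [this, hc]; ring
  have r0 := aux_rm p a q hp ha hq (0 : K) (by simp; omega)
  have rc := aux_rm p a q hp ha hq c hcq
  generalize ((X ^ q + X : K[X]) * ((X ^ q + X) ^ (q - 1) - 1) ^ (q + 1)) = f at *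
  have hf : f ≠ 0 := by rintro rfl; simp at r0
  have key : ∀ d : K, e * rootMultiplicity d X + M * rootMultiplicity d Q =
      M * rootMultiplicity d P + i * rootMultiplicity d f := by
    intro d
    have := congrArg (rootMultiplicity d) h
    rw [rootMultiplicity_mul (mul_ne_zero (pow_ne_zero _ X_ne_zero) (pow_ne_zero _ hQ)),
      rootMultiplicity_mul (mul_ne_zero (pow_ne_zero _ hP) (pow_ne_zero _ hf))] at this
    classical
    simp only [← count_roots, roots_pow, Multiset.count_nsmul] at this ⊢
    simpa using this
  have k0 := key 0
  have kc := key c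
  have x0 : rootMultiplicity (0 : K) X = 1 := by
    have := rootMultiplicity_X_sub_C_self (x := (0 : K)); simpa using this
  have xc : rootMultiplicity c X = 0 := rootMultiplicity_eq_zero (by simpa [IsRoot.def] using hc0)
  rw [r0, x0] at k0
  rw [rc, xc] at kc
  have hi : M ∣ i := by
    have : M ∣ M * rootMultiplicity c P + i * 1 := by rw [← kc]; simp
    simpa using (Nat.dvd_add_right (Dvd.intro _ rfl)).1 this
  have : M ∣ e * 1 + M * rootMultiplicity 0 Q := by
    rw [k0, mul_one]; exact dvd_add (Dvd.intro _ rfl) hi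
  simpa using (Nat.dvd_add_left (Dvd.intro _ rfl)).1 this

lemma aux_core {K F : Type*} [Field K] [IsAlgClosed K] [Field F] [Algebra K F] (p a q t N : ℕ)
    [CharP K p] (hp : p.Prime) (ha : 0 < a) (hq : q = p ^ a) (htK : (t : K) ≠ 0)
    (x y z : F) (h1 : z ^ t = y ^ (q ^ 2) - y) (h2 : y ^ (q + 1) = x ^ q + x)
    (hz : z ≠ 0) (htr : Transcendental K x)
    (hgen : ∀ S : IntermediateField K F, x ∈ S → y ∈ S → z ∈ S → S = ⊤)
    (hσ : ∀ u w : K, w ^ t = u → u ^ (q + 1) = 1 → ∃ σ : F →ₐ[K] F, σ x = x ∧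
      σ y = algebraMap K F u * y ∧ σ z = algebraMap K F w * z)
    (v : F) (hv : v ^ t = x ^ N) : t ∣ N := by
  have hq2 : 2 ≤ q := by
    rw [hq]; exact hp.two_le.trans (Nat.le_self_pow ha.ne' p)
  have hqK : (q : K) = 0 := by
    rw [hq]; push_cast; rw [CharP.cast_eq_zero, zero_pow ha.ne']
  have ht0 : t ≠ 0 := by rintro rfl; simp at htK
  have hx0 : x ≠ 0 := by
    rintro rfl; exact htr isAlgebraic_zero
  have hv0 : v ≠ 0 := by
    rintro rfl
    rw [zero_pow ht0] at hv
    exact pow_ne_zero _ hx0 hv.symm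
  set M := t * (q + 1) with hM
  have hM0 : M ≠ 0 := by positivity
  have hMK : (M : K) ≠ 0 := by simp [hM, hqK, htK]
  have : NeZero (M : K) := ⟨hMK⟩
  have : NeZero M := ⟨hM0⟩
  obtain ⟨ζ, hζ⟩ := HasEnoughRootsOfUnity.exists_primitiveRoot K M
  obtain ⟨σ, sx, sy, sz⟩ := hσ (ζ ^ t) ζ rfl (by rw [← pow_mul]; exact hζ.pow_eq_one)
  set f : K[X] := (X ^ q + X : K[X]) * ((X ^ q + X) ^ (q - 1) - 1) ^ (q + 1) with hf
  have hinj : Function.Injective (aeval x : K[X] →ₐ[K] F) :=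
    (transcendental_iff_injective).1 htr
  set U : K[X] := (X ^ q + X) ^ (q - 1) - 1 with hU
  have hyU : z ^ t = y * aeval x U := by
    simp only [hU, map_sub, map_pow, map_add, aeval_X, map_one, ← h2, h1]
    rw [mul_sub, ← pow_mul, ← pow_succ', mul_one]
    congr 2
    obtain ⟨k, rfl⟩ : ∃ k, q = k + 1 := ⟨q - 1, by omega⟩
    simp; ring
  have hzM : z ^ M = aeval x f := by
    rw [hM, pow_mul, hyU, mul_pow, h2]
    simp [hf, hU]
  have hU0 : aeval x U ≠ 0 := by
    intro h
    rw [h, mul_zero] at hyU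
    exact pow_ne_zero _ hz hyU
  let L := IntermediateField.adjoin K {x}
  have hxL : ∀ P : K[X], aeval x P ∈ L := fun P =>
    by
      have h := aeval_algebraMap_apply F (⟨x, IntermediateField.mem_adjoin_simple_self K x⟩ : L) P
      have h' : aeval x P = ((aeval (⟨x, IntermediateField.mem_adjoin_simple_self K x⟩ : L) P : L) : F) := h
      rw [h']
      exact SetLike.coe_mem _
  have hζF : IsPrimitiveRoot (algebraMap K F ζ) M := hζ.map_of_injective (algebraMap K F).injective
  have sL : ∀ g ∈ L, σ g = g := by
    intro g hg
    have : L ≤ IntermediateField.mk (AlgHom.equalizer σ (AlgHom.id K F)) (by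
        intro r hr
        have hr' : σ r = r := hr
        show σ r⁻¹ = r⁻¹
        rw [map_inv₀, hr']) := by
      rw [IntermediateField.adjoin_le_iff]
      rintro _ rfl
      exact sx
    exact this hg
  have sM : σ v ^ M = v ^ M := by
    rw [hM, pow_mul, pow_mul, ← map_pow, hv, map_pow, sx]
  obtain ⟨i, hi, hiv⟩ := hζF.eq_pow_of_pow_eq_one (ξ := σ v / v) (by
    rw [div_pow, sM, div_self (pow_ne_zero _ hv0)])
  have hsv : σ v = algebraMap K F ζ ^ i * v := by
    rw [hiv]; field_simp
  set g := v / z ^ i with hg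
  have hζ0 : algebraMap K F ζ ≠ 0 := hζF.ne_zero hM0
  have sg : σ g = g := by
    rw [hg, map_div₀, map_pow, sz, hsv, mul_pow, mul_div_mul_left _ _ (pow_ne_zero _ hζ0)]
  -- spanning
  have htop : ∀ r : F, ∃ P : L[X], r = aeval z P := by
    intro r
    have hzalg : IsAlgebraic L z := by
      refine IsAlgebraic.of_pow (Nat.pos_of_ne_zero hM0) ?_
      rw [hzM]
      exact isAlgebraic_algebraMap (⟨_, hxL f⟩ : L)
    have h3 : IntermediateField.adjoin L {z} = ⊤ := by
      have := hgen ((IntermediateField.adjoin L {z}).restrictScalars K) ?_ ?_ ?_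
      · rw [← IntermediateField.restrictScalars_eq_top_iff (K := K)]; exact this
      · exact (IntermediateField.adjoin L {z}).algebraMap_mem ⟨x, IntermediateField.mem_adjoin_simple_self K x⟩
      · have : y = z ^ t / aeval x U := by rw [hyU]; field_simp
        rw [this]
        refine div_mem (pow_mem (IntermediateField.mem_adjoin_simple_self L z) _) ?_
        exact (IntermediateField.adjoin L {z}).algebraMap_mem ⟨_, hxL U⟩
      · exact IntermediateField.mem_adjoin_simple_self L z
    have h4 : r ∈ (IntermediateField.adjoin L {z}).toSubalgebra := by rw [h3]; trivial
    rw [IntermediateField.adjoin_simple_toSubalgebra_of_isAlgebraic hzalg,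
      Algebra.adjoin_singleton_eq_range_aeval] at h4
    obtain ⟨P, hP⟩ := h4
    exact ⟨P, hP.symm⟩
  have hgL : g ∈ L := by
    obtain ⟨P, hP⟩ := htop g
    have hk : ∀ k : ℕ, g = ∑ j ∈ P.support, (P.coeff j : F) * ((algebraMap K F ζ ^ j) ^ k * z ^ j) := by
      intro k
      induction k with
      | zero =>
        conv_lhs => rw [hP, aeval_eq_sum_range, ]
        simp only [pow_zero, one_mul]
        rw [← aeval_eq_sum_range, aeval_def, eval₂_eq_sum, Polynomial.sum]
        rfl
      | succ k ih =>
        rw [← sg]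
        conv_lhs => rw [ih]
        rw [map_sum]
        refine Finset.sum_congr rfl fun j _ => ?_
        rw [map_mul, map_mul, map_pow, map_pow, map_pow, sz, AlgHom.commutes, sL _ (P.coeff j).2]
        ring
    have hsum : (M : F) * g = ∑ j ∈ P.support, (P.coeff j : F) *
        ((∑ k ∈ Finset.range M, (algebraMap K F ζ ^ j) ^ k) * z ^ j) := by
      have : ∑ k ∈ Finset.range M, g = (M : F) * g := by simp
      rw [← this, Finset.sum_congr rfl (fun k _ => hk k), Finset.sum_comm]
      refine Finset.sum_congr rfl fun j _ => ?_
      rw [Finset.sum_mul, Finset.mul_sum]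
    have hMF : (M : F) ≠ 0 := by
      rw [← map_natCast (algebraMap K F)]; exact (_root_.map_ne_zero _).2 hMK
    have : g = (∑ j ∈ P.support, (P.coeff j : F) *
        ((∑ k ∈ Finset.range M, (algebraMap K F ζ ^ j) ^ k) * z ^ j)) / (M : F) := by
      rw [← hsum]; field_simp
    rw [this]
    refine div_mem (sum_mem fun j _ => mul_mem (P.coeff j).2 ?_) (natCast_mem _ _)
    by_cases hj : M ∣ j
    · obtain ⟨l, rfl⟩ := hj
      rw [pow_mul z, hzM]
      refine mul_mem (sum_mem fun k _ => pow_mem (pow_mem (L.algebraMap_mem _) _) _) (pow_mem (hxL f) _)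
    · have hne : algebraMap K F ζ ^ j ≠ 1 := fun h => hj (hζF.dvd_of_pow_eq_one _ h)
      have : ∑ k ∈ Finset.range M, (algebraMap K F ζ ^ j) ^ k = 0 := by
        rw [geom_sum_eq hne, ← pow_mul, mul_comm, pow_mul, hζF.pow_eq_one]; simp
      rw [this, zero_mul]; exact zero_mem _
  obtain ⟨P, Q, hPQ⟩ := (IntermediateField.mem_adjoin_simple_iff K g).1 hgL
  have hg0 : g ≠ 0 := div_ne_zero hv0 (pow_ne_zero _ hz)
  have hP0 : aeval x P ≠ 0 := by
    intro h; rw [h, zero_div] at hPQ; exact hg0 hPQ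
  have hQ0 : aeval x Q ≠ 0 := by
    intro h; rw [h, div_zero] at hPQ; exact hg0 hPQ
  have hfin : M ∣ N * (q + 1) := by
    refine aux_poly p a q hp ha hq M i (N * (q + 1)) P Q (by rintro rfl; simp at hP0)
      (by rintro rfl; simp at hQ0) (hinj ?_)
    rw [← hf]
    have e1 : v ^ M = x ^ (N * (q + 1)) := by rw [hM, pow_mul, hv, ← pow_mul]
    have e2 : v = aeval x P / aeval x Q * z ^ i := by
      rw [← hPQ, hg]; field_simp
    rw [map_mul, map_mul, map_pow, map_pow, map_pow, map_pow, aeval_X, ← e1, ← hzM, e2, mul_pow, div_pow]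
    field_simp
    ring
  exact Nat.dvd_of_mul_dvd_mul_right (by omega) hfin

end Polynomial

namespace Polynomial

lemma aux_main {K F : Type*} [Field K] [IsAlgClosed K] [Field F] [Algebra K F] (p a q t : ℕ)
    [CharP K p] (hp : p.Prime) (ha : 0 < a) (hq : q = p ^ a) (ht0 : 0 < t) (htK : (t : K) ≠ 0)
    (x y z : F) (h1 : z ^ t = y ^ (q ^ 2) - y) (h2 : y ^ (q + 1) = x ^ q + x)
    (htr : Transcendental K x)
    (hgen : ∀ S : IntermediateField K F, x ∈ S → y ∈ S → z ∈ S → S = ⊤)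
    (hlift : ∀ x' y' z' : F, z' ^ t = y' ^ (q ^ 2) - y' → y' ^ (q + 1) = x' ^ q + x' →
      Transcendental K x' → ∃ φ : F →ₐ[K] F, φ x = x' ∧ φ y = y' ∧ φ z = z') :
    (∃ σ : F ≃ₐ[K] F, σ x = x⁻¹ ∧ σ y = y / x) ↔ t ∣ q ^ 2 - q + 1 := by
  have hF : CharP F p := charP_of_injective_algebraMap (algebraMap K F).injective p
  have hq2 : 2 ≤ q := by
    rw [hq]; exact hp.two_le.trans (Nat.le_self_pow ha.ne' p)
  have hle : q ≤ q ^ 2 := Nat.le_self_pow (by norm_num) q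
  have hx0 : x ≠ 0 := by
    rintro rfl; exact htr isAlgebraic_zero
  have hw := aux_w p a q hp hq x y hx0 h2
  obtain ⟨u, hu⟩ := IsAlgClosed.exists_pow_nat_eq (-1 : K) ht0
  have hu' : algebraMap K F u ^ t = -1 := by rw [← map_pow, hu]; simp
  have hu0 : algebraMap K F u ≠ 0 := by
    intro h; rw [h, zero_pow ht0.ne'] at hu'; simp at hu'
  have hz0 : z ≠ 0 := by
    rintro rfl
    rw [zero_pow ht0.ne'] at h1
    have hya : IsAlgebraic K y := by
      refine ⟨X ^ (q ^ 2) - X, ?_, by simp [← h1]⟩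
      exact FiniteField.X_pow_card_sub_X_ne_zero K (by nlinarith)
    have hxa : IsAlgebraic K (aeval x (X ^ q + X : K[X])) := by
      simp only [map_add, map_pow, aeval_X, ← h2]
      exact hya.pow _
    have hdeg : (X ^ q + X : K[X]).natDegree = q := by
      rw [natDegree_add_eq_left_of_natDegree_lt] <;> simp only [natDegree_X_pow, natDegree_X]
      omega
    refine (htr.aeval (X ^ q + X : K[X]) ?_ ?_) hxa
    rotate_left
    · rw [mem_nonZeroDivisors_iff_ne_zero, Ne, leadingCoeff_eq_zero]
      intro h
      rw [h, natDegree_zero] at hdeg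
      omega
    · omega
  constructor
  · rintro ⟨σ, sx, sy⟩
    have hσz : σ z ≠ 0 := by simpa using hz0
    have h3 : σ z ^ t = -(z ^ t) / x ^ (q ^ 2 - q + 1) := by
      rw [← map_pow, h1, map_sub, map_pow, sy, hw]
    refine aux_core p a q t _ hp ha hq htK x y z h1 h2 hz0 htr hgen ?_
      (algebraMap K F u * z / σ z) ?_
    · intro b c hbc hb
      refine hlift x (algebraMap K F b * y) (algebraMap K F c * z) ?_ ?_ htr
      · have hb2 : b ^ (q ^ 2) = b := by
          have : q ^ 2 = (q + 1) * (q - 1) + 1 := by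
            obtain ⟨k, rfl⟩ : ∃ k, q = k + 1 := ⟨q - 1, by omega⟩
            simp; ring
          rw [this, pow_succ, pow_mul, hb]; simp
        rw [mul_pow, mul_pow, ← map_pow, ← map_pow, hbc, h1, hb2]; ring
      · rw [mul_pow, ← map_pow, hb, h2]; simp
    · rw [div_pow, mul_pow, hu', h3]
      have := pow_ne_zero t hz0
      have := pow_ne_zero (q ^ 2 - q + 1) hx0
      field_simp
  · rintro ⟨k, hk⟩
    have g1 : (algebraMap K F u * z / x ^ k) ^ t = (y / x) ^ (q ^ 2) - y / x := by
      rw [hw, div_pow, mul_pow, hu', ← pow_mul, mul_comm k, ← hk, h1]; ring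
    have g2 : (y / x) ^ (q + 1) = x⁻¹ ^ q + x⁻¹ := by
      rw [div_pow, h2, inv_pow, pow_succ]
      have := pow_ne_zero q hx0
      field_simp
      ring
    have g3 : Transcendental K x⁻¹ := by
      intro h
      exact htr (by simpa using h.inv)
    obtain ⟨φ, px, py, pz⟩ := hlift x⁻¹ (y / x) (algebraMap K F u * z / x ^ k) g1 g2 g3
    · have hs : φ.fieldRange = ⊤ := by
        have mx : x ∈ φ.fieldRange := by
          have : x⁻¹ ∈ φ.fieldRange := ⟨x, px⟩
          simpa using inv_mem this
        refine hgen _ mx ?_ ?_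
        · have : y / x ∈ φ.fieldRange := ⟨y, py⟩
          have h := mul_mem this mx
          rwa [div_mul_cancel₀ _ hx0] at h
        · have : algebraMap K F u * z / x ^ k ∈ φ.fieldRange := ⟨z, pz⟩
          have h := mul_mem (inv_mem (φ.fieldRange.algebraMap_mem u)) (mul_mem this (pow_mem mx k))
          rwa [div_mul_cancel₀ _ (pow_ne_zero _ hx0), inv_mul_cancel_left₀ hu0] at h
      have hsurj : Function.Surjective φ := by
        intro r
        have : r ∈ φ.fieldRange := by rw [hs]; trivial
        exact this
      exact ⟨AlgEquiv.ofBijective φ ⟨φ.injective, hsurj⟩, px, py⟩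

end Polynomial

section lifting
set_option synthInstance.maxHeartbeats 1000000
set_option maxHeartbeats 2000000

/-- The coordinate function `z`. -/
noncomputable def Yz (K : Type) [Field K] (q t : ℕ) : YField K q t :=
  algebraMap (YRing K q t) (YField K q t) (Ideal.Quotient.mk _ (X 2))

lemma Yrel1 (K : Type) [Field K] (q t : ℕ) :
    Yz K q t ^ t = Yy K q t ^ (q ^ 2) - Yy K q t := by
  have h : (Ideal.Quotient.mk (YIdeal K q t)) (X 2 ^ t - (X 1 ^ (q ^ 2) - X 1)) = 0 :=
    Ideal.Quotient.eq_zero_iff_mem.2 (Ideal.subset_span (by simp))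
  have := congrArg (algebraMap (YRing K q t) (YField K q t)) h
  simp only [map_sub, map_pow, map_zero] at this
  exact sub_eq_zero.1 this

lemma Yrel2 (K : Type) [Field K] (q t : ℕ) :
    Yy K q t ^ (q + 1) = Yx K q t ^ q + Yx K q t := by
  have h : (Ideal.Quotient.mk (YIdeal K q t)) (X 1 ^ (q + 1) - (X 0 ^ q + X 0)) = 0 :=
    Ideal.Quotient.eq_zero_iff_mem.2 (Ideal.subset_span (by simp))
  have := congrArg (algebraMap (YRing K q t) (YField K q t)) h
  simp only [map_sub, map_pow, map_zero, map_add] at this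
  exact sub_eq_zero.1 this

/-- Homomorphisms out of the coordinate ring. -/
lemma Yring_lift (K : Type) [Field K] (q t : ℕ) {B : Type} [CommRing B] [Algebra K B]
    (x y z : B) (h1 : z ^ t = y ^ (q ^ 2) - y) (h2 : y ^ (q + 1) = x ^ q + x) :
    ∃ φ : YRing K q t →ₐ[K] B, φ (Ideal.Quotient.mk _ (X 0)) = x ∧
      φ (Ideal.Quotient.mk _ (X 1)) = y ∧ φ (Ideal.Quotient.mk _ (X 2)) = z := by
  refine ⟨Ideal.Quotient.liftₐ (YIdeal K q t) (MvPolynomial.aeval ![x, y, z]) ?_, ?_, ?_, ?_⟩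
  · intro r hr
    have : YIdeal K q t ≤ RingHom.ker (MvPolynomial.aeval ![x, y, z] : _ →ₐ[K] B) := by
      rw [YIdeal, Ideal.span_le]
      rintro _ (rfl | rfl)
      · simp [RingHom.mem_ker, h1]
      · simp [RingHom.mem_ker, h2]
    exact this hr
  · erw [Ideal.Quotient.liftₐ_apply, Ideal.Quotient.lift_mk]; simp
  · erw [Ideal.Quotient.liftₐ_apply, Ideal.Quotient.lift_mk]; simp
  · erw [Ideal.Quotient.liftₐ_apply, Ideal.Quotient.lift_mk]; simp

lemma Yx_transcendental (K : Type) [Field K] [IsAlgClosed K] (q t : ℕ) (ht : 0 < t)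
    [(YIdeal K q t).IsPrime] : Transcendental K (Yx K q t) := by
  rw [transcendental_iff]
  intro P hP
  have h0 : Polynomial.aeval (Ideal.Quotient.mk (YIdeal K q t) (X 0)) P = 0 := by
    rw [Yx, Polynomial.aeval_algebraMap_apply] at hP
    exact (FaithfulSMul.algebraMap_injective (YRing K q t) (YField K q t)) (by rw [hP, map_zero])
  refine Polynomial.funext fun c => ?_
  obtain ⟨y, hy⟩ := IsAlgClosed.exists_pow_nat_eq (c ^ q + c) (n := q + 1) (by omega)
  obtain ⟨z, hz⟩ := IsAlgClosed.exists_pow_nat_eq (y ^ (q ^ 2) - y) (n := t) ht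
  obtain ⟨φ, hφ, -, -⟩ := Yring_lift K q t c y z hz hy
  have := congrArg φ h0
  rw [← Polynomial.aeval_algHom_apply, hφ, map_zero] at this
  simpa using this

lemma Ygen (K : Type) [Field K] (q t : ℕ) [(YIdeal K q t).IsPrime]
    (S : IntermediateField K (YField K q t)) (hx : Yx K q t ∈ S) (hy : Yy K q t ∈ S)
    (hz : Yz K q t ∈ S) : S = ⊤ := by
  have key : ∀ r : YRing K q t, algebraMap (YRing K q t) (YField K q t) r ∈ S := by
    intro r
    obtain ⟨P, rfl⟩ := Ideal.Quotient.mk_surjective r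
    induction P using MvPolynomial.induction_on with
    | C c => exact S.algebraMap_mem c
    | add P Q hP hQ => rw [map_add, map_add]; exact add_mem hP hQ
    | mul_X P i hP =>
      rw [map_mul, map_mul]
      refine mul_mem hP ?_
      fin_cases i
      · exact hx
      · exact hy
      · exact hz
  rw [eq_top_iff]
  intro r _
  obtain ⟨b, c, -, rfl⟩ := IsFractionRing.div_surjective (A := YRing K q t) r
  exact div_mem (key b) (key c)

lemma Yfield_lift (K : Type) [Field K] [IsAlgClosed K] (q t : ℕ) (ht : 0 < t) (hq : 2 ≤ q)
    [(YIdeal K q t).IsPrime] (x y z : YField K q t) (h1 : z ^ t = y ^ (q ^ 2) - y)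
    (h2 : y ^ (q + 1) = x ^ q + x) (hx : Transcendental K x) :
    ∃ φ : YField K q t →ₐ[K] YField K q t,
      φ (Yx K q t) = x ∧ φ (Yy K q t) = y ∧ φ (Yz K q t) = z := by
  obtain ⟨φ, px, py, pz⟩ := Yring_lift K q t x y z h1 h2
  let ψ : Polynomial K →+* YRing K q t :=
    (Polynomial.aeval (Ideal.Quotient.mk (YIdeal K q t) (X 0)) : _ →ₐ[K] _).toRingHom
  have hψ : ψ.IsIntegral := by
    have iy : ψ.IsIntegralElem (Ideal.Quotient.mk _ (X 1)) := by
      have : ψ.IsIntegralElem ((Ideal.Quotient.mk (YIdeal K q t) (X 1)) ^ (q + 1)) := by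
        have e : (Ideal.Quotient.mk (YIdeal K q t) (X 1)) ^ (q + 1) =
            ψ (Polynomial.X ^ q + Polynomial.X) := by
          have h : (Ideal.Quotient.mk (YIdeal K q t)) (X 1 ^ (q + 1) - (X 0 ^ q + X 0)) = 0 :=
            Ideal.Quotient.eq_zero_iff_mem.2 (Ideal.subset_span (by simp))
          rw [map_sub, sub_eq_zero] at h
          simpa [ψ] using h
        rw [e]; exact ψ.isIntegralElem_map
      algebraize [ψ]
      exact IsIntegral.of_pow (by omega) this
    have iz : ψ.IsIntegralElem (Ideal.Quotient.mk _ (X 2)) := by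
      have : ψ.IsIntegralElem ((Ideal.Quotient.mk (YIdeal K q t) (X 2)) ^ t) := by
        have e : (Ideal.Quotient.mk (YIdeal K q t) (X 2)) ^ t =
            (Ideal.Quotient.mk (YIdeal K q t) (X 1)) ^ (q ^ 2) -
            (Ideal.Quotient.mk (YIdeal K q t) (X 1)) := by
          have h : (Ideal.Quotient.mk (YIdeal K q t)) (X 2 ^ t - (X 1 ^ (q ^ 2) - X 1)) = 0 :=
            Ideal.Quotient.eq_zero_iff_mem.2 (Ideal.subset_span (by simp))
          rw [map_sub, sub_eq_zero] at h
          simpa using h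
        rw [e]
        algebraize [ψ]
        exact (IsIntegral.pow iy _).sub iy
      algebraize [ψ]
      exact IsIntegral.of_pow ht this
    intro r
    obtain ⟨P, rfl⟩ := Ideal.Quotient.mk_surjective r
    induction P using MvPolynomial.induction_on with
    | C c =>
      have e : Ideal.Quotient.mk (YIdeal K q t) (C c) = ψ (Polynomial.C c) := by
        simp only [ψ, AlgHom.toRingHom_eq_coe, RingHom.coe_coe, Polynomial.aeval_C]; rfl
      rw [e]; exact ψ.isIntegralElem_map
    | add P Q hP hQ => rw [map_add]; exact hP.add ψ hQ
    | mul_X P i hP =>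
      rw [map_mul]
      refine hP.mul ψ ?_
      fin_cases i
      · have e : Ideal.Quotient.mk (YIdeal K q t) (X 0) = ψ Polynomial.X := by simp [ψ]
        simp only [Fin.zero_eta]
        rw [e]; exact ψ.isIntegralElem_map
      · exact iy
      · exact iz
  have hφ : Function.Injective φ := by
    have h0 : (RingHom.ker (φ : YRing K q t →+* YField K q t)) = ⊥ := by
      algebraize [ψ]
      refine Ideal.eq_bot_of_comap_eq_bot (R := Polynomial K) ?_
      rw [eq_bot_iff]
      intro P hP
      have hP' : φ (ψ P) = 0 := hP
      simp only [ψ, AlgHom.toRingHom_eq_coe, RingHom.coe_coe] at hP'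
      rw [← Polynomial.aeval_algHom_apply, px] at hP'
      exact (transcendental_iff.1 hx) P hP'
    exact (RingHom.injective_iff_ker_eq_bot _).2 h0
  refine ⟨IsFractionRing.liftAlgHom hφ, ?_, ?_, ?_⟩
  · rw [IsFractionRing.liftAlgHom_apply, Yx, IsFractionRing.lift_algebraMap]; exact px
  · rw [IsFractionRing.liftAlgHom_apply, Yy, IsFractionRing.lift_algebraMap]; exact py
  · rw [IsFractionRing.liftAlgHom_apply, Yz, IsFractionRing.lift_algebraMap]; exact pz

end lifting

set_option synthInstance.maxHeartbeats 1000000 in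
set_option maxHeartbeats 2000000 in
/-- Theorem: there exists an automorphism `σ ∈ Aut(F/K)` with `σ x = 1/x` and
`σ y = y/x` if and only if `3 ∣ n` and `(m/s) ∣ q^2 - q + 1`. -/
theorem stmt8 (p a q n m s : ℕ) (hp : p.Prime) (ha : 0 < a) (hq : q = p ^ a)
    (hn : 3 ≤ n) (hodd : Odd n) (hm : m * (q + 1) = q ^ n + 1)
    (hs : s ∣ m) (hs0 : 0 < s) (hsm : s ≠ m)
    (K : Type) [Field K] [IsAlgClosed K] [CharP K p]
    [hI : (YIdeal K q (m / s)).IsPrime] :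
    (∃ σ : YField K q (m / s) ≃ₐ[K] YField K q (m / s),
        σ (Yx K q (m / s)) = (Yx K q (m / s))⁻¹ ∧
        σ (Yy K q (m / s)) = Yy K q (m / s) / Yx K q (m / s)) ↔
      (3 ∣ n ∧ m / s ∣ q ^ 2 - q + 1) := by
  have htm : m / s ∣ m := Nat.div_dvd_of_dvd hs
  have hm0 : m ≠ 0 := by rintro rfl; simp at hm
  have ht1 : 1 < m / s := by
    obtain ⟨k, rfl⟩ := hs
    rw [Nat.mul_div_cancel_left k hs0]
    rcases k with _ | _ | k
    · simp at hm0
    · simp at hsm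
    · omega
  have hq2 : 2 ≤ q := by
    rw [hq]; exact hp.two_le.trans (Nat.le_self_pow ha.ne' p)
  have hqK : (q : K) = 0 := by
    rw [hq]; push_cast; rw [CharP.cast_eq_zero, zero_pow ha.ne']
  have htK : ((m / s : ℕ) : K) ≠ 0 := by
    intro h
    obtain ⟨k, hk⟩ := htm
    have h1 : (m : K) = 0 := by rw [hk]; push_cast; rw [h, zero_mul]
    have h2 := congrArg (Nat.cast (R := K)) hm
    push_cast at h2
    rw [h1, hqK, zero_pow (by omega)] at h2
    simp at h2
  clear hsm hs hs0
  generalize m / s = t at *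
  have ht0 : 0 < t := by omega
  have h1 := Yrel1 K q t
  have h2 := Yrel2 K q t
  have htr := Yx_transcendental K q t ht0
  have hgen := Ygen K q t
  have hlift := Yfield_lift K q t ht0 hq2
  rw [Polynomial.aux_main p a q t hp ha hq ht0 htK _ _ _ h1 h2 htr hgen hlift]
  exact ⟨fun h => ⟨Polynomial.aux_three q n m t hodd hm ht1 htm h, h⟩, fun h => h.2⟩
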